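/- Any graph that has an end of infinite vertex-degree contains infinitely many pairwise edge-disjoint double rays. -/

import Mathlib

open SimpleGraph

variable {V : Type*}

/-- A ray in `G`: an injective sequence of vertices with consecutive vertices adjacent. -/
def IsRay (G : SimpleGraph V) (f : ℕ → V) : Prop :=
  Function.Injective f ∧ ∀ n, G.Adj (f n) (f (n + 1))

/-- A double ray in `G`: an injective two-way infinite sequence with consecutive
vertices adjacent. -/
def IsDoubleRay (G : SimpleGraph V) (f : ℤ → V) : Prop :=
  Function.Injective f ∧ ∀ n, G.Adj (f n) (f (n + 1))

/-- The edges used by a ray. -/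
def rayEdges (f : ℕ → V) : Set (Sym2 V) := {e | ∃ n, e = s(f n, f (n + 1))}

/-- The edges used by a double ray. -/
def drEdges (f : ℤ → V) : Set (Sym2 V) := {e | ∃ n : ℤ, e = s(f n, f (n + 1))}

/-- Two rays are equivalent (belong to the same end) iff no finite vertex set
separates them: for every finite `S` there are tails of both rays avoiding `S`
which are joined by a walk avoiding `S`. -/
def RayEquiv (G : SimpleGraph V) (f g : ℕ → V) : Prop :=
  ∀ S : Finset V, ∃ a b, (∀ i, a ≤ i → f i ∉ S) ∧ (∀ j, b ≤ j → g j ∉ S) ∧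
    ∃ w : G.Walk (f a) (g b), ∀ v ∈ w.support, v ∉ S

/-- The forward ray of a double ray. -/
def drFwd (f : ℤ → V) : ℕ → V := fun n => f n

/-- The backward ray of a double ray. -/
def drBwd (f : ℤ → V) : ℕ → V := fun n => f (-(n : ℤ) - 1)

/-- The end (represented by the ray `R`) has vertex-degree exactly `k`:
there are `k` pairwise vertex-disjoint rays equivalent to `R`, but not `k + 1`. -/
def EndVertexDegree (G : SimpleGraph V) (R : ℕ → V) (k : ℕ) : Prop :=
  (∃ F : Fin k → ℕ → V, (∀ i, IsRay G (F i) ∧ RayEquiv G R (F i)) ∧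
      Pairwise fun i j => Disjoint (Set.range (F i)) (Set.range (F j))) ∧
  ¬ ∃ F : Fin (k + 1) → ℕ → V, (∀ i, IsRay G (F i) ∧ RayEquiv G R (F i)) ∧
      Pairwise fun i j => Disjoint (Set.range (F i)) (Set.range (F j))

/-- `u` and `v` are joined by a walk of `G` avoiding `S`. -/
def JoinedOff (G : SimpleGraph V) (S : Finset V) (u v : V) : Prop :=
  ∃ w : G.Walk u v, ∀ x ∈ w.support, x ∉ S

lemma JoinedOff.symm {G : SimpleGraph V} {S : Finset V} {u v : V} (h : JoinedOff G S u v) :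
    JoinedOff G S v u := by
  obtain ⟨w, hw⟩ := h
  exact ⟨w.reverse, by simpa using hw⟩

lemma JoinedOff.trans {G : SimpleGraph V} {S : Finset V} {u v x : V} (h : JoinedOff G S u v)
    (h' : JoinedOff G S v x) : JoinedOff G S u x := by
  obtain ⟨w, hw⟩ := h
  obtain ⟨w', hw'⟩ := h'
  refine ⟨w.append w', fun y hy => ?_⟩
  rcases (Walk.mem_support_append_iff _ _).1 hy with hy | hy
  exacts [hw y hy, hw' y hy]

lemma IsRay.exists_walk {G : SimpleGraph V} {f : ℕ → V} (hf : IsRay G f) (a k : ℕ) :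
    ∃ w : G.Walk (f a) (f (a + k)), ∀ x ∈ w.support, ∃ i, a ≤ i ∧ x = f i := by
  induction k with
  | zero => exact ⟨Walk.nil, by simpa using ⟨a, le_rfl, rfl⟩⟩
  | succ k ih =>
    obtain ⟨w, hw⟩ := ih
    refine ⟨w.concat (hf.2 (a + k)), fun x hx => ?_⟩
    rw [Walk.support_concat, List.mem_append, List.mem_singleton] at hx
    rcases hx with hx | rfl
    · exact hw x hx
    · exact ⟨a + k + 1, by omega, rfl⟩

lemma IsRay.joinedOff {G : SimpleGraph V} {f : ℕ → V} (hf : IsRay G f) {S : Finset V} {c : ℕ}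
    (hc : ∀ i, c ≤ i → f i ∉ S) {a b : ℕ} (ha : c ≤ a) (hb : c ≤ b) :
    JoinedOff G S (f a) (f b) := by
  have key : ∀ a k, c ≤ a → JoinedOff G S (f a) (f (a + k)) := by
    intro a k ha
    obtain ⟨w, hw⟩ := hf.exists_walk a k
    refine ⟨w, fun x hx => ?_⟩
    obtain ⟨i, hi, rfl⟩ := hw x hx
    exact hc i (by omega)
  rcases le_total a b with hab | hab
  · obtain ⟨k, rfl⟩ := Nat.exists_eq_add_of_le hab
    exact key a k ha
  · obtain ⟨k, rfl⟩ := Nat.exists_eq_add_of_le hab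
    exact (key b k hb).symm

lemma Function.Injective.exists_tail_notMem {f : ℕ → V} (hf : Function.Injective f)
    (S : Finset V) : ∃ c, ∀ i, c ≤ i → f i ∉ S := by
  have hfin : (f ⁻¹' (S : Set V)).Finite := S.finite_toSet.preimage hf.injOn
  obtain ⟨c, hc⟩ := hfin.bddAbove
  refine ⟨c + 1, fun i hi hS => ?_⟩
  have := hc (show i ∈ f ⁻¹' (S : Set V) from hS)
  omega

lemma IsRay.tail {G : SimpleGraph V} {f : ℕ → V} (hf : IsRay G f) (c : ℕ) :
    IsRay G (fun m => f (c + m)) :=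
  ⟨fun a b h => by have := hf.1 h; omega, fun n => hf.2 (c + n)⟩

/-- Equivalence to a ray only depends on the tail of the other ray. -/
lemma RayEquiv.of_tail_eq {G : SimpleGraph V} {W f f' : ℕ → V} (hf : IsRay G f)
    (h : RayEquiv G W f) {c d : ℕ} (hcd : ∀ m, f' (c + m) = f (d + m)) : RayEquiv G W f' := by
  intro S
  obtain ⟨a, b, ha, hb, w⟩ := h S
  refine ⟨a, c + b, ha, fun j hj => ?_, ?_⟩
  · obtain ⟨k, rfl⟩ := Nat.exists_eq_add_of_le hj
    rw [add_assoc, hcd]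
    exact hb _ (by omega)
  · rw [hcd]
    exact JoinedOff.trans w (hf.joinedOff hb le_rfl (by omega))

lemma RayEquiv.joinedOff {G : SimpleGraph V} {W f g : ℕ → V} (hW : IsRay G W)
    (hf : RayEquiv G W f) (hg : RayEquiv G W g) (S : Finset V) :
    ∃ a b, JoinedOff G S (f a) (g b) := by
  obtain ⟨a, b, ha, -, w⟩ := hf S
  obtain ⟨a', b', ha', -, w'⟩ := hg S
  refine ⟨b, b', JoinedOff.trans (JoinedOff.symm w) (JoinedOff.trans ?_ w')⟩
  rcases le_total a a' with h | h
  · exact hW.joinedOff ha le_rfl h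
  · exact hW.joinedOff ha' h le_rfl

/-- Follow `p` up to (excluding) position `k`, then `q` from position `l` on. -/
def switchAt (p : ℕ → V) (k : ℕ) (q : ℕ → V) (l : ℕ) : ℕ → V :=
  fun m => if m < k then p m else q (l + (m - k))

lemma IsRay.switchAt {G : SimpleGraph V} {p q : ℕ → V} (hp : IsRay G p) (hq : IsRay G q)
    {k l : ℕ} (hkl : p k = q l) (hd : ∀ u < k, ∀ v, l ≤ v → p u ≠ q v) :
    IsRay G (switchAt p k q l) := by
  constructor
  · intro a b hab
    simp only [_root_.switchAt] at hab
    split_ifs at hab with h1 h2 h2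
    · exact hp.1 hab
    · exact absurd hab (hd a h1 _ (by omega))
    · exact absurd hab.symm (hd b h2 _ (by omega))
    · have := hq.1 hab
      omega
  · intro n
    simp only [_root_.switchAt]
    split_ifs with h1 h2 h2
    · exact hp.2 n
    · obtain rfl : k = n + 1 := by omega
      simpa [← hkl] using hp.2 n
    · omega
    · have := hq.2 (l + (n - k))
      rwa [show l + (n + 1 - k) = l + (n - k) + 1 by omega]

/-- A walk with minimal length between two sets meets them only at its ends. -/
lemma exists_path_between {G : SimpleGraph V} (A B Z : Set V)
    (h : ∃ u v, ∃ w : G.Walk u v, u ∈ A ∧ v ∈ B ∧ ∀ x ∈ w.support, x ∈ Z) :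
    ∃ u v, ∃ w : G.Walk u v, w.IsPath ∧ u ∈ A ∧ v ∈ B ∧ (∀ x ∈ w.support, x ∈ Z) ∧
      (∀ x ∈ w.support, x ∈ A → x = u) ∧ (∀ x ∈ w.support, x ∈ B → x = v) := by
  classical
  have hex : ∃ n, ∃ u v, ∃ w : G.Walk u v, w.length = n ∧ u ∈ A ∧ v ∈ B ∧
      ∀ x ∈ w.support, x ∈ Z := by
    obtain ⟨u, v, w, h⟩ := h
    exact ⟨_, u, v, w, rfl, h⟩
  obtain ⟨u, v, w, hlen, hu, hv, hZ⟩ := Nat.find_spec hex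
  have hmin : ∀ u' v' (w' : G.Walk u' v'), u' ∈ A → v' ∈ B → (∀ x ∈ w'.support, x ∈ Z) →
      w.length ≤ w'.length := fun u' v' w' h1 h2 h3 => by
    rw [hlen]
    exact Nat.find_min' hex ⟨u', v', w', rfl, h1, h2, h3⟩
  refine ⟨u, v, w.bypass, w.bypass_isPath, hu, hv,
    fun x hx => hZ x (w.support_bypass_subset_support hx), fun x hx hA => ?_, fun x hx hB => ?_⟩
  · have hx := w.support_bypass_subset_support hx
    have h1 := hmin x v (w.dropUntil x hx) hA hv
      fun y hy => hZ y (w.support_dropUntil_subset_support hx hy)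
    have h2 : (w.takeUntil x hx).length + (w.dropUntil x hx).length = w.length := by
      rw [← Walk.length_append, w.take_spec hx]
    exact (Walk.eq_of_length_eq_zero (p := w.takeUntil x hx) (by omega)).symm
  · have hx := w.support_bypass_subset_support hx
    have h1 := hmin u x (w.takeUntil x hx) hu hB
      fun y hy => hZ y (w.support_takeUntil_subset_support hx hy)
    have h2 : (w.takeUntil x hx).length + (w.dropUntil x hx).length = w.length := by
      rw [← Walk.length_append, w.take_spec hx]
    exact Walk.eq_of_length_eq_zero (p := w.dropUntil x hx) (by omega)

lemma IsRay.exists_prepend {G : SimpleGraph V} {g : ℕ → V} (hg : IsRay G g) {u v : V}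
    (p : G.Walk u v) (hp : p.IsPath) (hv : g 0 = v)
    (hd : ∀ x ∈ p.support, x ∈ Set.range g → x = v) :
    ∃ g', IsRay G g' ∧ g' 0 = u ∧ ∀ m, g' m ∈ p.support ∨ g' m ∈ Set.range g := by
  induction p with
  | nil => exact ⟨g, hg, hv, fun m => Or.inr ⟨m, rfl⟩⟩
  | @cons u x v hadj p ih =>
    rw [Walk.cons_isPath_iff] at hp
    obtain ⟨g', hg', h0, hr⟩ := ih hp.1 hv fun y hy => hd y (by simp [hy])
    have hu : ∀ m, g' m ≠ u := by
      intro m hm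
      rcases hr m with h | h
      · exact hp.2 (hm ▸ h)
      · have := hd u (by simp) (hm ▸ h)
        exact hp.2 (this ▸ p.end_mem_support)
    refine ⟨fun n => Nat.casesOn n u g', ⟨?_, ?_⟩, rfl, ?_⟩
    · rintro (_ | a) (_ | b) hab
      · rfl
      · exact absurd hab.symm (hu b)
      · exact absurd hab (hu a)
      · rw [hg'.1 hab]
    · rintro (_ | n)
      · simpa [h0] using hadj
      · exact hg'.2 n
    · rintro (_ | n)
      · simp
      · rcases hr n with h | h
        · simp [h]
        · exact Or.inr h

lemma exists_doubleRay_of_common_start {G : SimpleGraph V} {f g : ℕ → V} (hf : IsRay G f)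
    (hg : IsRay G g) (h0 : f 0 = g 0) (hd : ∀ m n, f (m + 1) ≠ g n) :
    ∃ D, IsDoubleRay G D ∧ Set.range D ⊆ Set.range f ∪ Set.range g := by
  refine ⟨fun n => if 0 ≤ n then g n.toNat else f (-n).toNat, ⟨?_, ?_⟩, ?_⟩
  · have hne : ∀ a b : ℤ, a < 0 → f (-a).toNat ≠ g b.toNat := fun a b ha => by
      obtain ⟨k, hk⟩ : ∃ k, (-a).toNat = k + 1 := ⟨(-a).toNat - 1, by omega⟩
      rw [hk]
      exact hd _ _
    intro a b hab
    dsimp only at hab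
    split_ifs at hab with h1 h2 h2
    · have := hg.1 hab
      omega
    · exact absurd hab.symm (hne _ _ (by omega))
    · exact absurd hab (hne _ _ (by omega))
    · have := hf.1 hab
      omega
  · intro n
    dsimp only
    split_ifs with h1 h2 h2
    · rw [show (n + 1).toNat = n.toNat + 1 by omega]
      exact hg.2 _
    · omega
    · obtain rfl : n = -1 := by omega
      simpa [← h0] using (hf.2 0).symm
    · rw [show (-n).toNat = (-(n + 1)).toNat + 1 by omega]
      exact (hf.2 _).symm
  · rintro _ ⟨n, rfl⟩
    dsimp only
    split_ifs
    · exact Or.inr ⟨_, rfl⟩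
    · exact Or.inl ⟨_, rfl⟩

/-- Two disjoint rays joined by a walk give a double ray. -/
lemma exists_doubleRay_of_walk {G : SimpleGraph V} {f g : ℕ → V} (hf : IsRay G f)
    (hg : IsRay G g) (hd : Disjoint (Set.range f) (Set.range g)) {a b : ℕ}
    (w : G.Walk (f a) (g b)) :
    ∃ D, IsDoubleRay G D ∧ ∀ x ∈ Set.range D,
      x ∈ w.support ∨ x ∈ Set.range f ∨ x ∈ Set.range g := by
  obtain ⟨_, _, p, hp, ⟨c, rfl⟩, ⟨d, rfl⟩, hZ, hA, hB⟩ :=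
    exists_path_between (Set.range f) (Set.range g) {x | x ∈ w.support}
      ⟨_, _, w, ⟨a, rfl⟩, ⟨b, rfl⟩, fun x hx => hx⟩
  obtain ⟨g', hg', h0, hr⟩ := (hg.tail d).exists_prepend p hp rfl (by
    rintro x hx ⟨m, rfl⟩
    exact hB _ hx ⟨_, rfl⟩)
  obtain ⟨D, hD, hDr⟩ := exists_doubleRay_of_common_start (hf.tail c) hg' h0.symm (by
    intro m n hmn
    rcases hr n with h | ⟨k, hk⟩
    · have := hf.1 (hA _ (hmn ▸ h) ⟨_, rfl⟩)
      omega
    · exact Set.disjoint_left.1 hd ⟨_, hmn⟩ ⟨_, hk⟩)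
  refine ⟨D, hD, fun x hx => ?_⟩
  rcases hDr hx with ⟨m, rfl⟩ | ⟨m, rfl⟩
  · exact Or.inr (Or.inl ⟨_, rfl⟩)
  · rcases hr m with h | ⟨k, hk⟩
    · exact Or.inl (hZ _ h)
    · exact Or.inr (Or.inr ⟨_, hk⟩)

/-- Rays `i` and `j` of the family `R` are joined outside `S` by a walk meeting no other member
of the family. -/
def LinkedOff (G : SimpleGraph V) (R : ℕ → ℕ → V) (S : Finset V) (i j : ℕ) : Prop :=
  ∃ a b, ∃ w : G.Walk (R i a) (R j b), (∀ x ∈ w.support, x ∉ S) ∧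
    ∀ x ∈ w.support, ∀ k, x ∈ Set.range (R k) → k = i ∨ k = j

lemma LinkedOff.symm {G : SimpleGraph V} {R : ℕ → ℕ → V} {S : Finset V} {i j : ℕ}
    (h : LinkedOff G R S i j) : LinkedOff G R S j i := by
  obtain ⟨a, b, w, h1, h2⟩ := h
  refine ⟨b, a, w.reverse, by simpa using h1, fun x hx k hk => ?_⟩
  exact (h2 x (by simpa using hx) k hk).symm

lemma LinkedOff.mono {G : SimpleGraph V} {R : ℕ → ℕ → V} {S T : Finset V} {i j : ℕ}
    (h : LinkedOff G R T i j) (hST : S ⊆ T) : LinkedOff G R S i j := by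
  obtain ⟨a, b, w, h1, h2⟩ := h
  exact ⟨a, b, w, fun x hx hS => h1 x hx (hST hS), h2⟩

lemma exists_linkedOff {G : SimpleGraph V} {R : ℕ → ℕ → V} {S : Finset V} {i : ℕ}
    (hdisj : Pairwise fun i j => Disjoint (Set.range (R i)) (Set.range (R j)))
    (h : ∃ j, j ≠ i ∧ ∃ a b, JoinedOff G S (R i a) (R j b)) :
    ∃ j, j ≠ i ∧ LinkedOff G R S i j := by
  obtain ⟨j, hj, a, b, w, hw⟩ := h
  obtain ⟨_, _, p, -, ⟨a', rfl⟩, ⟨j', hj', b', rfl⟩, hZ, -, hB⟩ :=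
    exists_path_between (Set.range (R i)) {x | ∃ j, j ≠ i ∧ x ∈ Set.range (R j)} {x | x ∉ S}
      ⟨_, _, w, ⟨a, rfl⟩, ⟨j, hj, b, rfl⟩, hw⟩
  refine ⟨j', hj', a', b', p, hZ, fun x hx k hk => ?_⟩
  by_contra! hne
  have := hB x hx ⟨k, hne.1, hk⟩
  exact Set.disjoint_left.1 (hdisj hne.2) hk ⟨b', this.symm⟩

/-- Data of a double ray that runs in the finite set `T` and the rays with indices in `K`. -/
def IsRoutedDoubleRay (G : SimpleGraph V) (R : ℕ → ℕ → V) (C : Set ℕ)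
    (D : (ℤ → V) × Finset V × Finset ℕ) : Prop :=
  IsDoubleRay G D.1 ∧ (∀ x ∈ Set.range D.1, x ∈ D.2.1 ∨ ∃ k ∈ D.2.2, x ∈ Set.range (R k)) ∧
    (∀ k ∈ D.2.2, k ∉ C) ∧ ∀ k, k ∉ C → k ∉ D.2.2 → ∀ x ∈ D.2.1, x ∉ Set.range (R k)

lemma exists_disjoint_doubleRays {G : SimpleGraph V} {R : ℕ → ℕ → V}
    (hdisj : Pairwise fun i j => Disjoint (Set.range (R i)) (Set.range (R j))) (C : Set ℕ)
    (h : ∀ (S : Finset V) (J : Finset ℕ), ∃ D, IsRoutedDoubleRay G R C D ∧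
      Disjoint S D.2.1 ∧ Disjoint J D.2.2) :
    ∃ F : ℕ → ℤ → V, (∀ i, IsDoubleRay G (F i)) ∧
      Pairwise fun i j => Disjoint (Set.range (F i)) (Set.range (F j)) := by
  classical
  obtain ⟨D, hD, hr⟩ := exists_seq_of_forall_finset_exists (IsRoutedDoubleRay G R C)
    (fun D E => Disjoint D.2.1 E.2.1 ∧ Disjoint D.2.2 E.2.2) (by
      intro s _
      obtain ⟨E, hE, h1, h2⟩ := h (s.biUnion fun D => D.2.1) (s.biUnion fun D => D.2.2)
      rw [Finset.disjoint_biUnion_left] at h1 h2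
      exact ⟨E, hE, fun x hx => ⟨h1 x hx, h2 x hx⟩⟩)
  have key : ∀ m n, m < n → Disjoint (Set.range (D m).1) (Set.range (D n).1) := by
    intro m n hmn
    obtain ⟨hT, hK⟩ := hr m n hmn
    rw [Finset.disjoint_left] at hT hK
    rw [Set.disjoint_left]
    intro x hxm hxn
    obtain ⟨-, hm1, hm2, hm3⟩ := hD m
    obtain ⟨-, hn1, hn2, hn3⟩ := hD n
    rcases hm1 x hxm with hm | ⟨k, hk, hkx⟩ <;> rcases hn1 x hxn with hn | ⟨l, hl, hlx⟩
    · exact hT hm hn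
    · exact hm3 l (hn2 l hl) (fun hl' => hK hl' hl) x hm hlx
    · exact hn3 k (hm2 k hk) (hK hk) x hn hkx
    · by_cases hkl : k = l
      · exact hK hk (hkl ▸ hl)
      · exact Set.disjoint_left.1 (hdisj hkl) hkx hlx
  refine ⟨fun n => (D n).1, fun n => (hD n).1, fun m n hmn => ?_⟩
  rcases lt_or_gt_of_ne hmn with h | h
  exacts [key m n h, (key n m h).symm]

/-- A ray linked to infinitely many others of the family serves as a hub for double rays. -/
lemma exists_routedDoubleRay_of_hub {G : SimpleGraph V} {R : ℕ → ℕ → V}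
    (hR : ∀ i, IsRay G (R i))
    (hdisj : Pairwise fun i j => Disjoint (Set.range (R i)) (Set.range (R j))) {c : ℕ}
    (hc : ∀ (S : Finset V) (J : Finset ℕ), ∃ j, j ∉ J ∧ j ≠ c ∧ LinkedOff G R S c j)
    (S : Finset V) (J : Finset ℕ) :
    ∃ D, IsRoutedDoubleRay G R {c} D ∧ Disjoint S D.2.1 ∧ Disjoint J D.2.2 := by
  classical
  obtain ⟨M, hM⟩ := (hR c).1.exists_tail_notMem S
  set S' := S ∪ (Finset.range M).image (R c) with hS'
  obtain ⟨i, hiJ, hic, a, i', p, hpS, hpR⟩ := hc S' J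
  obtain ⟨j, hjJ, hjc, b, j', q, hqS, hqR⟩ := hc S' (insert i J)
  simp only [Finset.mem_insert, not_or] at hjJ
  have hbig : ∀ a, R c a ∉ S' → M ≤ a := by
    intro a ha
    by_contra! hlt
    exact ha (Finset.mem_union_right _ (Finset.mem_image_of_mem _ (Finset.mem_range.2 hlt)))
  have ha := hbig a (hpS _ p.start_mem_support)
  have hb := hbig b (hqS _ q.start_mem_support)
  have hseg : ∃ r : G.Walk (R c a) (R c b), ∀ x ∈ r.support, ∃ m, M ≤ m ∧ x = R c m := by
    rcases le_total a b with hab | hab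
    · obtain ⟨k, rfl⟩ := Nat.exists_eq_add_of_le hab
      obtain ⟨r, hr⟩ := (hR c).exists_walk a k
      exact ⟨r, fun x hx => (hr x hx).imp fun m hm => ⟨by omega, hm.2⟩⟩
    · obtain ⟨k, rfl⟩ := Nat.exists_eq_add_of_le hab
      obtain ⟨r, hr⟩ := (hR c).exists_walk b k
      refine ⟨r.reverse, fun x hx => ?_⟩
      rw [Walk.support_reverse, List.mem_reverse] at hx
      exact (hr x hx).imp fun m hm => ⟨by omega, hm.2⟩
  obtain ⟨r, hr⟩ := hseg
  set w := p.reverse.append (r.append q) with hw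
  have hsupp : ∀ x ∈ w.support, x ∈ p.support ∨ x ∈ r.support ∨ x ∈ q.support := by
    intro x hx
    simpa [hw, Walk.mem_support_append_iff] using hx
  have hij : i ≠ j := fun h => hjJ.1 h.symm
  obtain ⟨D, hD, hDr⟩ := exists_doubleRay_of_walk (hR i) (hR j) (hdisj hij) w
  refine ⟨(D, w.support.toFinset, {i, j}), ⟨hD, fun x hx => ?_, ?_, ?_⟩, ?_, ?_⟩
  · rcases hDr x hx with h | h | h
    · exact Or.inl (List.mem_toFinset.2 h)
    · exact Or.inr ⟨i, by simp, h⟩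
    · exact Or.inr ⟨j, by simp, h⟩
  · intro k hk
    simp only [Finset.mem_insert, Finset.mem_singleton] at hk
    rcases hk with rfl | rfl
    exacts [hic, hjc]
  · intro k hk hk' x hx hxk
    simp only [Finset.mem_insert, Finset.mem_singleton, not_or] at hk'
    rcases hsupp x (List.mem_toFinset.1 hx) with h | h | h
    · rcases hpR x h k hxk with h | h
      exacts [hk h, hk'.1 h]
    · obtain ⟨m, -, rfl⟩ := hr x h
      exact Set.disjoint_left.1 (hdisj hk) hxk ⟨m, rfl⟩
    · rcases hqR x h k hxk with h | h
      exacts [hk h, hk'.2 h]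
  · rw [Finset.disjoint_right]
    intro x hx
    rcases hsupp x (List.mem_toFinset.1 hx) with h | h | h
    · exact fun hS => hpS x h (Finset.mem_union_left _ hS)
    · obtain ⟨m, hm, rfl⟩ := hr x h
      exact hM m hm
    · exact fun hS => hqS x h (Finset.mem_union_left _ hS)
  · rw [Finset.disjoint_right]
    intro k hk
    simp only [Finset.mem_insert, Finset.mem_singleton] at hk
    rcases hk with rfl | rfl
    exacts [hiJ, hjJ.2]

/-- If no ray is linked to infinitely many others, pairs of mutually linked rays can be chosen
greedily. -/
lemma exists_routedDoubleRay_of_no_hub {G : SimpleGraph V} {R : ℕ → ℕ → V}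
    (hR : ∀ i, IsRay G (R i))
    (hdisj : Pairwise fun i j => Disjoint (Set.range (R i)) (Set.range (R j)))
    (hlink : ∀ (S : Finset V) (i : ℕ), ∃ j, j ≠ i ∧ LinkedOff G R S i j)
    (hc : ∀ c, ∃ (S : Finset V) (J : Finset ℕ), ∀ j, j ∉ J → j ≠ c → ¬ LinkedOff G R S c j)
    (S : Finset V) (J : Finset ℕ) :
    ∃ D, IsRoutedDoubleRay G R ∅ D ∧ Disjoint S D.2.1 ∧ Disjoint J D.2.2 := by
  classical
  choose T N hTN using hc
  obtain ⟨i, hi⟩ := Infinite.exists_notMem_finset (J ∪ J.biUnion N)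
  simp only [Finset.mem_union, Finset.mem_biUnion, not_or, not_exists, not_and] at hi
  have hpartner : ∃ j, j ≠ i ∧ ∀ S, LinkedOff G R S i j := by
    by_contra! hno
    have hno' : ∀ j, ∃ S, j ≠ i → ¬ LinkedOff G R S i j := fun j => by
      by_cases hj : j = i
      · exact ⟨∅, fun h => absurd hj h⟩
      · exact (hno j hj).imp fun S hS _ => hS
    choose U hU using hno'
    obtain ⟨j, hj, hl⟩ := hlink (T i ∪ (N i).biUnion U) i
    by_cases hjN : j ∈ N i
    · exact hU j hj (hl.mono ((Finset.subset_biUnion_of_mem U hjN).trans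
        Finset.subset_union_right))
    · exact hTN i j hjN hj (hl.mono Finset.subset_union_left)
  obtain ⟨j, hji, hl⟩ := hpartner
  have hjJ : j ∉ J := fun h => hTN j i (hi.2 j h) hji.symm (hl (T j)).symm
  obtain ⟨a, b, w, hwS, hwR⟩ := hl S
  obtain ⟨D, hD, hDr⟩ := exists_doubleRay_of_walk (hR i) (hR j) (hdisj hji.symm) w
  refine ⟨(D, w.support.toFinset, {i, j}), ⟨hD, fun x hx => ?_, ?_, ?_⟩, ?_, ?_⟩
  · rcases hDr x hx with h | h | h
    · exact Or.inl (List.mem_toFinset.2 h)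
    · exact Or.inr ⟨i, by simp, h⟩
    · exact Or.inr ⟨j, by simp, h⟩
  · simp
  · intro k _ hk x hx hxk
    simp only [Finset.mem_insert, Finset.mem_singleton] at hk
    exact hk (hwR x (List.mem_toFinset.1 hx) k hxk)
  · rw [Finset.disjoint_right]
    exact fun x hx => hwS x (List.mem_toFinset.1 hx)
  · rw [Finset.disjoint_right]
    intro k hk
    simp only [Finset.mem_insert, Finset.mem_singleton] at hk
    rcases hk with rfl | rfl
    exacts [hi.1, hjJ]

lemma exists_disjoint_doubleRays_of_rays {G : SimpleGraph V} {R : ℕ → ℕ → V}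
    (hR : ∀ i, IsRay G (R i))
    (hdisj : Pairwise fun i j => Disjoint (Set.range (R i)) (Set.range (R j)))
    (hjoin : ∀ (S : Finset V) (i : ℕ), ∃ j, j ≠ i ∧ ∃ a b, JoinedOff G S (R i a) (R j b)) :
    ∃ F : ℕ → ℤ → V, (∀ i, IsDoubleRay G (F i)) ∧
      Pairwise fun i j => Disjoint (Set.range (F i)) (Set.range (F j)) := by
  by_cases hc : ∃ c, ∀ (S : Finset V) (J : Finset ℕ), ∃ j, j ∉ J ∧ j ≠ c ∧ LinkedOff G R S c j
  · obtain ⟨c, hc⟩ := hc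
    exact exists_disjoint_doubleRays hdisj {c} (exists_routedDoubleRay_of_hub hR hdisj hc)
  · push Not at hc
    exact exists_disjoint_doubleRays hdisj ∅ (exists_routedDoubleRay_of_no_hub hR hdisj
      (fun S i => exists_linkedOff hdisj (hjoin S i)) hc)

/-- Discarding at most `K` elements of `B` per element of `I`, each element of `A` either has no
neighbour left or more than `K` of them. -/
lemma exists_few_or_many {α β : Type*} [DecidableEq α] [DecidableEq β] (r : α → β → Prop)
    [∀ a, DecidablePred (r a)] (K : ℕ) (A : Finset α) (B : Finset β) :
    ∃ I ⊆ A, ∃ B' ⊆ B, (∀ i ∈ I, ∀ b ∈ B', ¬ r i b) ∧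
      (∀ j ∈ A \ I, K < (B'.filter (r j)).card) ∧ B.card ≤ B'.card + K * I.card := by
  induction A using Finset.strongInduction generalizing B with
  | H A ih =>
    by_cases hA : ∀ j ∈ A, K < (B.filter (r j)).card
    · exact ⟨∅, by simp, B, subset_rfl, by simp, by simpa using hA, by simp⟩
    · push Not at hA
      obtain ⟨a, ha, hcard⟩ := hA
      obtain ⟨I, hI, B', hB', h1, h2, h3⟩ :=
        ih (A.erase a) (Finset.erase_ssubset ha) (B.filter fun b => ¬ r a b)
      have haI : a ∉ I := fun h => by simpa using hI h
      refine ⟨insert a I, ?_, B', hB'.trans (Finset.filter_subset _ _), ?_, ?_, ?_⟩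
      · exact Finset.insert_subset ha (hI.trans (Finset.erase_subset _ _))
      · intro i hi b hb
        rcases Finset.mem_insert.1 hi with rfl | hi
        · exact (Finset.mem_filter.1 (hB' hb)).2
        · exact h1 i hi b hb
      · intro j hj
        refine h2 j ?_
        simp only [Finset.mem_sdiff, Finset.mem_insert, not_or, Finset.mem_erase] at hj ⊢
        tauto
      · have := B.card_filter_add_card_filter_not (r a)
        rw [Finset.card_insert_of_notMem haI, Nat.mul_add]
        omega

/-- Stable matching of disjoint sequences `f j` with disjoint rays `g b`: each `f j` may switch to
its partner at position `t j` without meeting any used tail of the `g b` earlier. -/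
lemma exists_stable_switch {ι β : Type*} [DecidableEq ι] [DecidableEq β] [Nonempty β] (f : ι → ℕ → V)
    (g : β → ℕ → V) (J : Finset ι) (B : Finset β)
    (hf : ∀ i ∈ J, ∀ j ∈ J, i ≠ j → Disjoint (Set.range (f i)) (Set.range (f j)))
    (hg : ∀ b, Function.Injective (g b))
    (hgd : Pairwise fun b c => Disjoint (Set.range (g b)) (Set.range (g c)))
    [∀ j, DecidablePred fun b => ∃ u v, f j u = g b v]
    (hmany : ∀ j ∈ J, J.card < (B.filter fun b => ∃ u v, f j u = g b v).card) :
    ∃ (t : ι → ℕ) (p : ι → β) (s : ι → ℕ),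
      (∀ j ∈ J, p j ∈ B ∧ f j (t j) = g (p j) (s j)) ∧ Set.InjOn p J ∧
      ∀ j ∈ J, ∀ u < t j, ∀ i ∈ J, ∀ v, f j u = g (p i) v → v < s i := by
  let Inv : (ι → ℕ) → Prop := fun t => ∀ j ∈ J, ∀ u < t j, ∀ b ∈ B, ∀ v, f j u = g b v →
    ∃ i ∈ J, ∃ v', v < v' ∧ f i (t i) = g b v'
  have huniq : ∀ b c v v', g b v = g c v' → b = c ∧ v = v' := by
    intro b c v v' h
    have hbc : b = c := by
      by_contra hne
      exact Set.disjoint_left.1 (hgd hne) ⟨v, rfl⟩ ⟨v', h.symm⟩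
    subst hbc
    exact ⟨rfl, hg b h⟩
  have hbound : ∀ j ∈ J, ∃ M, ∀ t, Inv t → t j ≤ M := by
    intro j hj
    have hcross : ∀ b, ∃ u, b ∈ (B.filter fun b => ∃ u v, f j u = g b v) →
        ∃ v, f j u = g b v := fun b => by
      by_cases hb : ∃ u v, f j u = g b v
      · exact hb.imp fun u hu _ => hu
      · exact ⟨0, fun h => absurd (Finset.mem_filter.1 h).2 hb⟩
    choose u hu using hcross
    refine ⟨(B.filter fun b => ∃ u v, f j u = g b v).sup u, fun t ht => ?_⟩
    by_contra! hlt
    have hhold : ∀ b ∈ (B.filter fun b => ∃ u v, f j u = g b v),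
        ∃ i ∈ J, ∃ v', f i (t i) = g b v' := by
      intro b hb
      obtain ⟨v, hv⟩ := hu b hb
      obtain ⟨i, hi, v', -, h⟩ := ht j hj (u b) ((Finset.le_sup hb).trans_lt hlt) b
        (Finset.mem_filter.1 hb).1 v hv
      exact ⟨i, hi, v', h⟩
    have : Nonempty ι := ⟨j⟩
    choose! k hkJ hk using hhold
    refine absurd (Finset.card_le_card_of_injOn k hkJ ?_) (not_le.2 (hmany j hj))
    intro b hb c hc hbc
    obtain ⟨v, hv⟩ := hk b hb
    obtain ⟨v', hv'⟩ := hk c hc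
    rw [hbc] at hv
    exact (huniq _ _ _ _ (hv.symm.trans hv')).1
  choose! M hM using hbound
  have hbdd : BddAbove {n | ∃ t, Inv t ∧ ∑ j ∈ J, t j = n} := by
    refine ⟨∑ j ∈ J, M j, ?_⟩
    rintro _ ⟨t, ht, rfl⟩
    exact Finset.sum_le_sum fun j hj => hM j hj t ht
  obtain ⟨t, ht, hsum⟩ := Nat.sSup_mem (s := {n | ∃ t, Inv t ∧ ∑ j ∈ J, t j = n})
    ⟨_, fun _ => 0, fun j _ u hu => absurd hu (Nat.not_lt_zero u), rfl⟩ hbdd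
  have hmax : ∀ j ∈ J, ¬ Inv (Function.update t j (t j + 1)) := by
    intro j hj hinv
    have h1 := le_csSup hbdd ⟨_, hinv, rfl⟩
    rw [← hsum, Finset.sum_update_of_mem hj, ← Finset.add_sum_erase _ _ hj,
      Finset.sdiff_singleton_eq_erase] at h1
    omega
  -- Advancing `j` is allowed when its current crossing, if any, is beaten by another one.
  have hadv : ∀ j ∈ J, ∃ b ∈ B, ∃ v, f j (t j) = g b v ∧
      ∀ i ∈ J, i ≠ j → ∀ v', v < v' → f i (t i) ≠ g b v' := by
    intro j hj
    by_contra! hno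
    refine hmax j hj fun k hk u hu b hb v huv => ?_
    have hcur : ∀ b ∈ B, ∀ v, f j (t j) = g b v →
        ∃ i ∈ J, ∃ v', v < v' ∧ f i (Function.update t j (t j + 1) i) = g b v' := by
      intro b hb v hv
      obtain ⟨i, hi, hij, v', hvv', h⟩ := hno b hb v hv
      exact ⟨i, hi, v', hvv', by rwa [Function.update_of_ne hij]⟩
    by_cases hnew : k = j ∧ u = t j
    · obtain ⟨rfl, rfl⟩ := hnew
      exact hcur b hb v huv
    · have hu' : u < t k := by
        by_cases hkj : k = j
        · subst hkj
          rw [Function.update_self] at hu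
          have : u ≠ t k := fun h => hnew ⟨rfl, h⟩
          omega
        · rwa [Function.update_of_ne hkj] at hu
      obtain ⟨i, hi, v', hvv', h⟩ := ht k hk u hu' b hb v huv
      by_cases hij : i = j
      · subst hij
        obtain ⟨i', hi', v'', h1, h2⟩ := hcur b hb v' h
        exact ⟨i', hi', v'', hvv'.trans h1, h2⟩
      · exact ⟨i, hi, v', hvv', by rwa [Function.update_of_ne hij]⟩
  choose! p hpB s hs hbest using hadv
  have hinj : Set.InjOn p J := by
    intro i hi j hj hij
    by_contra hne
    have h1 := hs i hi
    have h2 := hs j hj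
    rcases lt_trichotomy (s i) (s j) with h | h | h
    · exact hbest i hi j hj (Ne.symm hne) _ h (by rw [h2, hij])
    · rw [hij, h, ← h2] at h1
      exact Set.disjoint_left.1 (hf i hi j hj hne) ⟨_, h1⟩ ⟨_, rfl⟩
    · exact hbest j hj i hi hne _ h (by rw [h1, hij])
  refine ⟨t, p, s, fun j hj => ⟨hpB j hj, hs j hj⟩, hinj, fun j hj u hu i hi v huv => ?_⟩
  obtain ⟨k, hk, v', hvv', h⟩ := ht j hj u hu (p i) (hpB i hi) v huv
  obtain ⟨h1, h2⟩ := huniq _ _ _ _ ((hs k hk).symm.trans h)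
  obtain rfl := hinj hk hi h1
  omega

/-- The first `n` members of `F` are pairwise disjoint rays equivalent to `W`. -/
def IsDisjointRays (G : SimpleGraph V) (W : ℕ → V) (n : ℕ) (F : ℕ → ℕ → V) : Prop :=
  (∀ i < n, IsRay G (F i) ∧ RayEquiv G W (F i)) ∧
    ∀ i < n, ∀ j < n, i ≠ j → Disjoint (Set.range (F i)) (Set.range (F j))

lemma exists_disjointRays_avoiding {G : SimpleGraph V} {W : ℕ → V}
    (h : ∀ k : ℕ, ∃ F : Fin k → ℕ → V, (∀ i, IsRay G (F i) ∧ RayEquiv G W (F i)) ∧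
      Pairwise fun i j => Disjoint (Set.range (F i)) (Set.range (F j)))
    (k : ℕ) (X : Finset V) :
    ∃ F : Fin k → ℕ → V, (∀ i, IsRay G (F i) ∧ RayEquiv G W (F i)) ∧
      (Pairwise fun i j => Disjoint (Set.range (F i)) (Set.range (F j))) ∧
      ∀ i m, F i m ∉ X := by
  obtain ⟨Q, hQ, hQd⟩ := h k
  choose c hc using fun i => (hQ i).1.1.exists_tail_notMem X
  refine ⟨fun i m => Q i (c i + m), fun i => ⟨(hQ i).1.tail _,
    (hQ i).2.of_tail_eq (hQ i).1 (c := 0) (d := c i) (by simp)⟩, fun i j hij => ?_,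
    fun i m => hc i _ (by omega)⟩
  refine (hQd hij).mono ?_ ?_ <;> rintro _ ⟨m, rfl⟩ <;> exact ⟨_, rfl⟩

/-- `n` disjoint rays can be rerouted after given initial segments to leave room for one more. -/
lemma IsDisjointRays.exists_extend {G : SimpleGraph V} {W : ℕ → V}
    (h : ∀ k : ℕ, ∃ F : Fin k → ℕ → V, (∀ i, IsRay G (F i) ∧ RayEquiv G W (F i)) ∧
      Pairwise fun i j => Disjoint (Set.range (F i)) (Set.range (F j)))
    {n : ℕ} {F : ℕ → ℕ → V} (hF : IsDisjointRays G W n F) (L : ℕ) :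
    ∃ F', IsDisjointRays G W (n + 1) F' ∧ ∀ i < n, ∀ m ≤ L, F' i m = F i m := by
  classical
  obtain ⟨hFr, hFd⟩ := hF
  let X : Finset V := (Finset.range n ×ˢ Finset.range (L + 1)).image fun q => F q.1 q.2
  have hX : ∀ i < n, ∀ m ≤ L, F i m ∈ X := fun i hi m hm =>
    Finset.mem_image.2 ⟨(i, m), by simp; omega, rfl⟩
  obtain ⟨g, hg, hgd, hgX⟩ := exists_disjointRays_avoiding h (n * n + n + 1) X
  obtain ⟨I, hI, B, -, hIB, hJB, hcard⟩ := exists_few_or_many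
    (fun i b => ∃ u v, F i u = g b v) n (Finset.range n) Finset.univ
  set J := Finset.range n \ I with hJ
  have hJn : ∀ j ∈ J, j < n := fun j hj =>
    Finset.mem_range.1 (Finset.sdiff_subset hj)
  have hJcard : J.card ≤ n := by
    simpa using Finset.card_le_card (Finset.sdiff_subset : J ⊆ Finset.range n)
  have hIcard : I.card ≤ n := by simpa using Finset.card_le_card hI
  obtain ⟨t, p, s, hmeet, hinj, hstable⟩ := exists_stable_switch F g J B
    (fun i hi j hj => hFd i (hJn i hi) j (hJn j hj)) (fun b => (hg b).1.1) hgd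
    (fun j hj => hJcard.trans_lt (hJB j hj))
  have hspare : ∃ b ∈ B, b ∉ J.image p := by
    refine Finset.exists_mem_notMem_of_card_lt_card ?_
    have h1 : (J.image p).card ≤ n := Finset.card_image_le.trans hJcard
    have h2 : n * I.card ≤ n * n := Nat.mul_le_mul_left _ hIcard
    rw [Finset.card_univ, Fintype.card_fin] at hcard
    omega
  obtain ⟨b₀, hb₀B, hb₀⟩ := hspare
  have hb₀' : ∀ j ∈ J, p j ≠ b₀ := fun j hj hjb => hb₀ (Finset.mem_image.2 ⟨j, hj, hjb⟩)
  have hIout : ∀ i < n, i ∉ J → ∀ b ∈ B, ∀ u v, F i u ≠ g b v := by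
    intro i hi hiJ b hb u v huv
    refine hIB i ?_ b hb ⟨u, v, huv⟩
    simpa [hJ, hi] using hiJ
  obtain ⟨d, hd⟩ := (hg b₀).1.1.exists_tail_notMem
    (J.biUnion fun j => (Finset.range (t j)).image (F j))
  have hLt : ∀ j ∈ J, L < t j := by
    intro j hj
    by_contra! hle
    exact hgX _ _ ((hmeet j hj).2 ▸ hX j (hJn j hj) _ hle)
  let F' : ℕ → ℕ → V := fun i => if i ∈ J then switchAt (F i) (t i) (g (p i)) (s i) else
    if i < n then F i else fun m => g b₀ (d + m)
  have hF'J : ∀ i ∈ J, F' i = switchAt (F i) (t i) (g (p i)) (s i) := fun i hi => if_pos hi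
  have hF'I : ∀ i < n, i ∉ J → F' i = F i := fun i hi hiJ => by simp [F', hi, hiJ]
  have hnJ : n ∉ J := fun hn => lt_irrefl n (hJn n hn)
  have hF'n : F' n = fun m => g b₀ (d + m) := by simp [F', hnJ]
  have hrange : ∀ i < n, ∀ x ∈ Set.range (F' i),
      (∃ u, (i ∈ J → u < t i) ∧ x = F i u) ∨ (i ∈ J ∧ ∃ v, s i ≤ v ∧ x = g (p i) v) := by
    rintro i hi _ ⟨m, rfl⟩
    by_cases hiJ : i ∈ J
    · rw [hF'J i hiJ]
      simp only [switchAt]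
      split_ifs with hm
      · exact Or.inl ⟨m, fun _ => hm, rfl⟩
      · exact Or.inr ⟨hiJ, _, by omega, rfl⟩
    · rw [hF'I i hi hiJ]
      exact Or.inl ⟨m, fun h => absurd h hiJ, rfl⟩
  have hcross : ∀ i < n, ∀ j ∈ J, ∀ u v, (i ∈ J → u < t i) → s j ≤ v →
      F i u ≠ g (p j) v := by
    intro i hi j hj u v hu hv huv
    by_cases hiJ : i ∈ J
    · have := hstable i hiJ u (hu hiJ) j hj v huv
      omega
    · exact hIout i hi hiJ _ (hmeet j hj).1 u v huv
  have hgne : ∀ b c, b ≠ c → ∀ u v, g b u ≠ g c v := fun b c hbc u v huv =>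
    Set.disjoint_left.1 (hgd hbc) ⟨u, rfl⟩ ⟨v, huv.symm⟩
  have hold : ∀ i < n, ∀ j < n, i ≠ j → Disjoint (Set.range (F' i)) (Set.range (F' j)) := by
    intro i hi j hj hij
    rw [Set.disjoint_left]
    intro x hxi hxj
    rcases hrange i hi x hxi with ⟨u, hu, rfl⟩ | ⟨hiJ, v, hv, rfl⟩ <;>
    rcases hrange j hj _ hxj with ⟨u', hu', h'⟩ | ⟨hjJ, v', hv', h'⟩
    · exact Set.disjoint_left.1 (hFd i hi j hj hij) ⟨u, rfl⟩ ⟨u', h'.symm⟩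
    · exact hcross i hi j hjJ u v' hu hv' h'
    · exact hcross j hj i hiJ u' v hu' hv h'.symm
    · exact hgne _ _ (fun h => hij (hinj hiJ hjJ h)) _ _ h'
  have hnew : ∀ i < n, Disjoint (Set.range (F' i)) (Set.range (F' n)) := by
    intro i hi
    rw [Set.disjoint_left]
    intro x hxi hxn
    rw [hF'n] at hxn
    obtain ⟨m, rfl⟩ := hxn
    rcases hrange i hi _ hxi with ⟨u, hu, h'⟩ | ⟨hiJ, v, hv, h'⟩
    · by_cases hiJ : i ∈ J
      · refine hd (d + m) (by omega) (Finset.mem_biUnion.2 ⟨i, hiJ, ?_⟩)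
        exact Finset.mem_image.2 ⟨u, Finset.mem_range.2 (hu hiJ), h'.symm⟩
      · exact hIout i hi hiJ b₀ hb₀B u _ h'.symm
    · exact hgne _ _ (hb₀' i hiJ) _ _ h'.symm
  refine ⟨F', ⟨fun i hi => ?_, fun i hi j hj hij => ?_⟩, fun i hi m hm => ?_⟩
  · rcases Nat.lt_succ_iff_lt_or_eq.1 hi with hi | rfl
    · by_cases hiJ : i ∈ J
      · rw [hF'J i hiJ]
        refine ⟨(hFr i hi).1.switchAt (hg _).1 (hmeet i hiJ).2 fun u hu v hv =>
          hcross i hi i hiJ u v (fun _ => hu) hv, ?_⟩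
        exact (hg (p i)).2.of_tail_eq (hg _).1 (c := t i) (d := s i) (by simp [switchAt])
      · rw [hF'I i hi hiJ]
        exact hFr i hi
    · rw [hF'n]
      exact ⟨(hg b₀).1.tail d, (hg b₀).2.of_tail_eq (hg b₀).1 (c := 0) (d := d) (by simp)⟩
  · rcases Nat.lt_succ_iff_lt_or_eq.1 hi with hi | rfl <;>
    rcases Nat.lt_succ_iff_lt_or_eq.1 hj with hj | rfl
    · exact hold i hi j hj hij
    · exact hnew i hi
    · exact (hnew j hj).symm
    · exact absurd rfl hij
  · by_cases hiJ : i ∈ J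
    · rw [hF'J i hiJ, switchAt, if_pos (hm.trans_lt (hLt i hiJ))]
    · rw [hF'I i hi hiJ]

lemma exists_seq_of_step {α : Type*} (P : ℕ → α → Prop) (Q : ℕ → α → α → Prop)
    (h0 : ∃ a, P 0 a) (hs : ∀ n a, P n a → ∃ b, P (n + 1) b ∧ Q n a b) :
    ∃ f : ℕ → α, (∀ n, P n (f n)) ∧ ∀ n, Q n (f n) (f (n + 1)) := by
  obtain ⟨a, ha⟩ := h0
  choose next hnext hQ using hs
  let f : ∀ n, {a // P n a} := fun n =>
    Nat.rec ⟨a, ha⟩ (fun n x => ⟨next n x.1 x.2, hnext n x.1 x.2⟩) n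
  exact ⟨fun n => (f n).1, fun n => (f n).2, fun n => hQ n (f n).1 (f n).2⟩

/-- Halin's theorem: an end containing arbitrarily many disjoint rays yields infinitely many
disjoint rays, none of which can be finitely separated from all the others. -/
lemma exists_infinite_disjoint_rays {G : SimpleGraph V} {W : ℕ → V} (hW : IsRay G W)
    (h : ∀ k : ℕ, ∃ F : Fin k → ℕ → V, (∀ i, IsRay G (F i) ∧ RayEquiv G W (F i)) ∧
      Pairwise fun i j => Disjoint (Set.range (F i)) (Set.range (F j))) :
    ∃ R : ℕ → ℕ → V, (∀ i, IsRay G (R i)) ∧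
      (Pairwise fun i j => Disjoint (Set.range (R i)) (Set.range (R j))) ∧
      ∀ (S : Finset V) (i : ℕ), ∃ j, j ≠ i ∧ ∃ a b, JoinedOff G S (R i a) (R j b) := by
  classical
  -- A state consists of a family of rays, the length of the fixed initial segments and the
  -- vertices of the connecting walks chosen so far.
  obtain ⟨f, hP, hQ⟩ := exists_seq_of_step (α := (ℕ → ℕ → V) × ℕ × Finset V)
    (fun n s => IsDisjointRays G W n s.1 ∧ n ≤ s.2.1)
    (fun n s s' => (∀ i < n, ∀ m ≤ s.2.1, s'.1 i m = s.1 i m) ∧ s.2.1 ≤ s'.2.1 ∧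
      s.2.2 ⊆ s'.2.2 ∧ ∀ i < n + 1, ∃ a ≤ s'.2.1, ∃ b ≤ s'.2.1,
        ∃ w : G.Walk (s'.1 i a) (s'.1 0 b), ∀ x ∈ w.support, x ∉ s.2.2 ∧ x ∈ s'.2.2)
    ⟨(fun _ => W, 0, ∅), ⟨by simp, by simp⟩, le_rfl⟩ (by
      rintro n ⟨F, L, T⟩ ⟨hF, hL⟩
      obtain ⟨F', hF', hagree⟩ := hF.exists_extend h L
      have hwalk : ∀ i, ∃ (M : ℕ) (U : Finset V), i < n + 1 → ∃ a ≤ M, ∃ b ≤ M,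
          ∃ w : G.Walk (F' i a) (F' 0 b), ∀ x ∈ w.support, x ∉ T ∧ x ∈ U := by
        intro i
        by_cases hi : i < n + 1
        · obtain ⟨a, b, w, hw⟩ :=
            RayEquiv.joinedOff hW (hF'.1 i hi).2 (hF'.1 0 (by omega)).2 T
          exact ⟨max a b, w.support.toFinset, fun _ => ⟨a, le_max_left _ _, b, le_max_right _ _,
            w, fun x hx => ⟨hw x hx, List.mem_toFinset.2 hx⟩⟩⟩
        · exact ⟨0, ∅, fun h => absurd h hi⟩
      choose M U hMU using hwalk
      refine ⟨(F', (L + 1) ⊔ (Finset.range (n + 1)).sup M, T ∪ (Finset.range (n + 1)).biUnion U),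
        ⟨hF', ?_⟩, hagree, ?_, Finset.subset_union_left, fun i hi => ?_⟩
      · exact (Nat.succ_le_succ hL).trans le_sup_left
      · exact (Nat.le_succ L).trans le_sup_left
      · obtain ⟨a, ha, b, hb, w, hw⟩ := hMU i hi
        have hi' := Finset.mem_range.2 hi
        have hM : M i ≤ (L + 1) ⊔ (Finset.range (n + 1)).sup M :=
          (Finset.le_sup hi').trans le_sup_right
        exact ⟨a, ha.trans hM, b, hb.trans hM, w, fun x hx => ⟨(hw x hx).1,
          Finset.mem_union_right _ (Finset.mem_biUnion.2 ⟨i, hi', (hw x hx).2⟩)⟩⟩)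
  have hLmono : Monotone fun n => (f n).2.1 := monotone_nat_of_le_succ fun n => (hQ n).2.1
  have hTmono : Monotone fun n => (f n).2.2 := monotone_nat_of_le_succ fun n => (hQ n).2.2.1
  have hagree : ∀ n N, n ≤ N → ∀ i < n, ∀ m ≤ (f n).2.1, (f N).1 i m = (f n).1 i m := by
    intro n N hnN i hi m hm
    induction N, hnN using Nat.le_induction with
    | base => rfl
    | succ N hN ih =>
      rw [(hQ N).1 i (by omega) m (hm.trans (hLmono hN)), ih]
  let R : ℕ → ℕ → V := fun i m => (f (i + m + 1)).1 i m
  have hR : ∀ n, ∀ i < n, ∀ m ≤ (f n).2.1, R i m = (f n).1 i m := by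
    intro n i hi m hm
    have h1 := hagree n (n + (i + m + 1)) (by omega) i hi m hm
    have h2 := hagree (i + m + 1) (n + (i + m + 1)) (by omega) i (by omega) m
      (le_trans (by omega) (hP (i + m + 1)).2)
    exact h2.symm.trans h1
  have hR' : ∀ n, ∀ i < n, ∀ m ≤ n, R i m = (f n).1 i m := fun n i hi m hm =>
    hR n i hi m (hm.trans (hP n).2)
  refine ⟨R, fun i => ⟨fun a b hab => ?_, fun m => ?_⟩, fun i j hij => ?_, fun S i => ?_⟩
  · rw [hR' (i + a + b + 1) i (by omega) a (by omega),
      hR' (i + a + b + 1) i (by omega) b (by omega)] at hab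
    exact ((hP _).1.1 i (by omega)).1.1 hab
  · rw [hR' (i + m + 1) i (by omega) m (by omega), hR' (i + m + 1) i (by omega) _ (by omega)]
    exact ((hP _).1.1 i (by omega)).1.2 m
  · refine Set.disjoint_left.2 ?_
    rintro _ ⟨a, rfl⟩ ⟨b, hb⟩
    rw [hR' (i + j + a + b + 1) i (by omega) a (by omega),
      hR' (i + j + a + b + 1) j (by omega) b (by omega)] at hb
    exact Set.disjoint_left.1 ((hP _).1.2 i (by omega) j (by omega) hij) ⟨a, rfl⟩ ⟨b, hb⟩
  · have hzero : ∀ i, ∃ a b, JoinedOff G S (R i a) (R 0 b) := by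
      intro i
      have hlate : ∀ x, ∃ N, (∃ n, x ∈ (f n).2.2) → x ∈ (f N).2.2 := fun x => by
        by_cases hx : ∃ n, x ∈ (f n).2.2
        · exact hx.imp fun n hn _ => hn
        · exact ⟨0, fun h => absurd h hx⟩
      choose N hN using hlate
      set n := max i (S.sup N) with hn
      obtain ⟨a, ha, b, hb, w, hw⟩ := (hQ n).2.2.2 i (by omega)
      refine ⟨a, b, ?_⟩
      rw [hR (n + 1) i (by omega) a ha, hR (n + 1) 0 (by omega) b hb]
      refine ⟨w, fun x hx hxS => (hw x hx).1 ?_⟩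
      exact hTmono ((Finset.le_sup hxS).trans (le_max_right _ _)) (hN x ⟨_, (hw x hx).2⟩)
    by_cases hi : i = 0
    · subst hi
      obtain ⟨a, b, hab⟩ := hzero 1
      exact ⟨1, one_ne_zero, b, a, hab.symm⟩
    · exact ⟨0, Ne.symm hi, hzero i⟩

lemma disjoint_drEdges {D E : ℤ → V} (h : Disjoint (Set.range D) (Set.range E)) :
    Disjoint (drEdges D) (drEdges E) := by
  rw [Set.disjoint_left]
  rintro _ ⟨m, rfl⟩ ⟨n, hn⟩
  have hm : D m ∈ s(E n, E (n + 1)) := hn ▸ Sym2.mem_mk_left _ _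
  rcases Sym2.mem_iff.1 hm with h' | h'
  · exact Set.disjoint_left.1 h ⟨m, rfl⟩ ⟨_, h'.symm⟩
  · exact Set.disjoint_left.1 h ⟨m, rfl⟩ ⟨_, h'.symm⟩

/-- Any graph with an end of infinite vertex-degree (arbitrarily many pairwise
vertex-disjoint rays in the end) contains infinitely many pairwise edge-disjoint
double rays. -/
theorem stmt_6 (G : SimpleGraph V) (W : ℕ → V) (hW : IsRay G W)
    (h : ∀ k : ℕ, ∃ F : Fin k → ℕ → V, (∀ i, IsRay G (F i) ∧ RayEquiv G W (F i)) ∧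
      Pairwise fun i j => Disjoint (Set.range (F i)) (Set.range (F j))) :
    ∃ F : ℕ → ℤ → V, (∀ i, IsDoubleRay G (F i)) ∧
      Pairwise fun i j => Disjoint (drEdges (F i)) (drEdges (F j)) := by
  obtain ⟨R, hR, hdisj, hjoin⟩ := exists_infinite_disjoint_rays hW h
  obtain ⟨F, hF, hFd⟩ := exists_disjoint_doubleRays_of_rays hR hdisj hjoin
  exact ⟨F, hF, fun i j hij => disjoint_drEdges (hFd hij)⟩
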